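/- Let X be a first countable, locally compact, paracompact Hausdorff topological space and let f : X → X be a topologically Anosov homeomorphism. Then f is topologically stable: for any neighborhood B of Δ_X there exists a neighborhood D of Δ_X such that for any homeomorphism g : X → X satisfying (f(x), g(x)) ∈ D for all x ∈ X, there exists a continuous map h : X → X satisfying (h(x), x) ∈ B for all x ∈ X and f ∘ h = h ∘ g. -/

import Mathlib

open Set Topology

namespace TopAnosovPaper

variable {X Y : Type*}

section Defs

variable [TopologicalSpace X]

/-- The `n`-th iterate (n ∈ ℤ) of a homeomorphism, as a function. -/
def iter (f : X ≃ₜ X) (n : ℤ) : X → X := ⇑(f.toEquiv ^ n)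

/-- `N` is an expansive neighborhood for `f`: a closed neighborhood of the
diagonal such that any two distinct points are eventually separated by `F = f × f`. -/
def IsExpansiveNbhd (f : X ≃ₜ X) (N : Set (X × X)) : Prop :=
  IsClosed N ∧ N ∈ nhdsSet (Set.diagonal X) ∧
    ∀ x y : X, x ≠ y → ∃ n : ℤ, (iter f n x, iter f n y) ∉ N

/-- `f` is topologically expansive. -/
def TopExpansive (f : X ≃ₜ X) : Prop := ∃ N : Set (X × X), IsExpansiveNbhd f N

/-- A `D`-pseudo-orbit: a bi-infinite sequence with `(f x_{i-1}, x_i) ∈ D`. -/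
def IsPseudoOrbit (f : X ≃ₜ X) (D : Set (X × X)) (x : ℤ → X) : Prop :=
  ∀ i : ℤ, (f (x (i - 1)), x i) ∈ D

/-- `y` `E`-traces the bi-infinite sequence `x`. -/
def Traces (f : X ≃ₜ X) (E : Set (X × X)) (y : X) (x : ℤ → X) : Prop :=
  ∀ i : ℤ, (iter f i y, x i) ∈ E

/-- `f` has the topological shadowing property. -/
def TopShadowing (f : X ≃ₜ X) : Prop :=
  ∀ E ∈ nhdsSet (Set.diagonal X), ∃ D ∈ nhdsSet (Set.diagonal X),
    ∀ x : ℤ → X, IsPseudoOrbit f D x → ∃ y : X, Traces f E y x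

/-- `f` is topologically Anosov: expansive with the shadowing property. -/
def TopAnosov (f : X ≃ₜ X) : Prop := TopExpansive f ∧ TopShadowing f

/-- An `A`-chain from `x` to `y` (of length `n ≥ 1`). -/
def IsChainFromTo (f : X ≃ₜ X) (A : Set (X × X)) (x y : X) : Prop :=
  ∃ n : ℕ, 1 ≤ n ∧ ∃ c : ℕ → X, c 0 = x ∧ c n = y ∧
    ∀ i : ℕ, 1 ≤ i → i ≤ n → (f (c (i - 1)), c i) ∈ A

/-- `x ∼ y`: for every neighborhood `A` of the diagonal there is an `A`-chain
from `x` to `y` and one from `y` to `x`. -/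
def ChainRel (f : X ≃ₜ X) (x y : X) : Prop :=
  ∀ A ∈ nhdsSet (Set.diagonal X), IsChainFromTo f A x y ∧ IsChainFromTo f A y x

/-- The chain recurrent set. -/
def CR (f : X ≃ₜ X) : Set X := {x | ChainRel f x x}

/-- `R` is a chain component: an equivalence class of `∼` restricted to `CR f`. -/
def IsChainComponent (f : X ≃ₜ X) (R : Set X) : Prop :=
  ∃ x ∈ CR f, R = {y | y ∈ CR f ∧ ChainRel f x y}

/-- The non-wandering set of `f`. -/
def NonWandering (f : X ≃ₜ X) : Set X :=
  {x | ∀ G : Set X, IsOpen G → x ∈ G → ∃ n : ℕ, 0 < n ∧ (iter f n '' G ∩ G).Nonempty}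

/-- `x` is a periodic point of `f`. -/
def Periodic (f : X ≃ₜ X) (x : X) : Prop := ∃ n : ℕ, 0 < n ∧ iter f n x = x

/-- The set of periodic points of `f`. -/
def Per (f : X ≃ₜ X) : Set X := {x | Periodic f x}

/-- A relation `M ⊆ X × X` is proper if `M[S]` is compact for every compact `S`. -/
def IsProperRel (M : Set (X × X)) : Prop :=
  ∀ S : Set X, IsCompact S → IsCompact {y : X | ∃ x ∈ S, (x, y) ∈ M}

/-- A set `U ⊆ X × X` is wide if `U ∪ (S × X) = X × X` for some compact `S`. -/
def IsWide (U : Set (X × X)) : Prop :=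
  ∃ S : Set X, IsCompact S ∧ U ∪ (S ×ˢ (Set.univ : Set X)) = Set.univ

/-- `E` is symmetric. -/
def SymmRel (E : Set (X × X)) : Prop := ∀ p : X × X, p ∈ E → (p.2, p.1) ∈ E

/-- `E² = {(x,y) : ∃ z, (x,z) ∈ E ∧ (z,y) ∈ E}`. -/
def sq (E : Set (X × X)) : Set (X × X) := {p : X × X | ∃ z : X, (p.1, z) ∈ E ∧ (z, p.2) ∈ E}

/-- The local stable set of `x` relative to `B`. -/
def WsLoc (f : X ≃ₜ X) (B : Set (X × X)) (x : X) : Set X :=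
  {y | ∀ i : ℤ, 0 ≤ i → (iter f i x, iter f i y) ∈ B}

/-- The local unstable set of `x` relative to `B`. -/
def WuLoc (f : X ≃ₜ X) (B : Set (X × X)) (x : X) : Set X :=
  {y | ∀ i : ℤ, i ≤ 0 → (iter f i x, iter f i y) ∈ B}

/-- The stable set of `x`. -/
def Ws (f : X ≃ₜ X) (x : X) : Set X :=
  {y | ∀ B ∈ nhdsSet (Set.diagonal X), ∃ n : ℕ, ∀ i : ℤ, (n : ℤ) ≤ i →
    (iter f i x, iter f i y) ∈ B}

/-- The unstable set of `x`. -/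
def Wu (f : X ≃ₜ X) (x : X) : Set X :=
  {y | ∀ B ∈ nhdsSet (Set.diagonal X), ∃ n : ℕ, ∀ i : ℤ, i ≤ -(n : ℤ) →
    (iter f i x, iter f i y) ∈ B}

/-- `f` restricted to `R` is topologically transitive: for any nonempty
relatively open subsets `G, H` of `R` there is `n ∈ ℕ` with `f^n(G) ∩ H ≠ ∅`. -/
def TransitiveOn (f : X ≃ₜ X) (R : Set X) : Prop :=
  ∀ G H : Set X, (∃ U : Set X, IsOpen U ∧ G = U ∩ R) → (∃ V : Set X, IsOpen V ∧ H = V ∩ R) →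
    G.Nonempty → H.Nonempty → ∃ n : ℕ, (iter f n '' G ∩ H).Nonempty

/-- `V_N(A)`: pairs whose first `N` forward and backward iterates all lie in `A`. -/
def VN (f : X ≃ₜ X) (A : Set (X × X)) (N : ℕ) : Set (X × X) :=
  {p : X × X | ∀ n : ℤ, |n| ≤ (N : ℤ) → (iter f n p.1, iter f n p.2) ∈ A}

/-- The `n`-th power (n ∈ ℕ) of a homeomorphism. -/
def hpowNat (f : X ≃ₜ X) : ℕ → X ≃ₜ X
  | 0 => Homeomorph.refl X
  | n + 1 => (hpowNat f n).trans f

/-- The `k`-th power (k ∈ ℤ) of a homeomorphism, as a homeomorphism. -/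
def hpow (f : X ≃ₜ X) : ℤ → X ≃ₜ X
  | Int.ofNat n => hpowNat f n
  | Int.negSucc n => (hpowNat f (n + 1)).symm

end Defs

end TopAnosovPaper

open TopAnosovPaper

namespace TopAnosovPaper

section Iterates

variable {X : Type*} [TopologicalSpace X]

lemma iter_add_one (f : X ≃ₜ X) (n : ℤ) (x : X) : iter f (n + 1) x = f (iter f n x) := by
  simp only [iter, add_comm n 1, zpow_add, zpow_one]
  rfl

lemma iter_add_one_apply (f : X ≃ₜ X) (n : ℤ) (x : X) :
    iter f (n + 1) x = iter f n (f x) := by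
  simp only [iter, zpow_add, zpow_one]
  rfl

lemma continuous_iter (f : X ≃ₜ X) (n : ℤ) : Continuous (iter f n) := by
  induction n with
  | zero => exact continuous_id
  | succ n ih =>
    rw [funext (iter_add_one f n)]
    exact f.continuous.comp ih
  | pred n ih =>
    have h : iter f (-(n : ℤ) - 1) = f.symm ∘ iter f (-(n : ℤ)) := by
      funext x
      have := iter_add_one f (-(n : ℤ) - 1) x
      rw [sub_add_cancel] at this
      simp [this]
    rw [h]
    exact f.symm.continuous.comp ih

end Iterates

section Diagonal

variable {X : Type*} [TopologicalSpace X]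

/-- A continuity criterion: a map with closed graph and locally relatively compact values. -/
lemma continuous_of_isClosed_graph_of_eventually_mem_compact {Y : Type*} [TopologicalSpace Y]
    {h : X → Y} (hG : IsClosed {p : X × Y | p.2 = h p.1})
    (hK : ∀ x, ∃ K : Set Y, IsCompact K ∧ ∀ᶠ x' in 𝓝 x, h x' ∈ K) : Continuous h := by
  refine continuous_iff_continuousAt.2 fun x => ?_
  obtain ⟨K, hKc, hKx⟩ := hK x
  refine hKc.tendsto_nhds_of_unique_mapClusterPt hKx fun y _ hy => ?_
  by_contra hne
  have hmem : {p : X × Y | p.2 = h p.1}ᶜ ∈ 𝓝 (x, y) := hG.isOpen_compl.mem_nhds hne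
  obtain ⟨U, hU, V, hV, hUV⟩ := mem_nhds_prod_iff.1 hmem
  obtain ⟨x', hx'V, hx'U⟩ := ((mapClusterPt_iff_frequently.1 hy V hV).and_eventually hU).exists
  exact hUV (Set.mk_mem_prod hx'U hx'V) rfl

/-- In a locally compact paracompact Hausdorff space, every neighborhood `M` of the diagonal
contains a closed neighborhood `E` of the diagonal which is proper in its first coordinate and
satisfies `E ∘ E⁻¹ ⊆ M`. -/
lemma exists_isClosed_nhdsSet_diagonal_comp_subset [LocallyCompactSpace X] [ParacompactSpace X]
    [T2Space X] {M : Set (X × X)} (hM : M ∈ nhdsSet (Set.diagonal X)) :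
    ∃ E ∈ nhdsSet (Set.diagonal X), IsClosed E ∧ E ⊆ M ∧
      (∀ a b z, (a, z) ∈ E → (b, z) ∈ E → (a, b) ∈ M) ∧
      ∀ x, ∃ K : Set X, IsCompact K ∧ ∀ᶠ x' in 𝓝 x, ∀ y, (y, x') ∈ E → y ∈ K := by
  have hloc : ∀ x : X, ∃ K : Set X, IsCompact K ∧ K ∈ 𝓝 x ∧ K ×ˢ K ⊆ M := by
    intro x
    have hx : M ∈ 𝓝 (x, x) := mem_nhdsSet_iff_forall.1 hM (x, x) rfl
    obtain ⟨U, hU, V, hV, hUV⟩ := mem_nhds_prod_iff.1 hx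
    obtain ⟨K, hK, hKU, hKc⟩ := local_compact_nhds (Filter.inter_mem hU hV)
    exact ⟨K, hKc, hK, (Set.prod_mono (hKU.trans inter_subset_left)
      (hKU.trans inter_subset_right)).trans hUV⟩
  choose K hKc hK hKM using hloc
  obtain ⟨v, hvo, hvU, hvf, hvK⟩ := precise_refinement (fun x => interior (K x))
    (fun _ => isOpen_interior)
    (Set.eq_univ_of_forall fun x => mem_iUnion.2 ⟨x, mem_interior_iff_mem_nhds.2 (hK x)⟩)
  obtain ⟨w, hwU, hwo, hwv⟩ := exists_iUnion_eq_closure_subset hvo hvf.point_finite hvU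
  have hcover : ∀ x, ∃ i, x ∈ w i := fun x => mem_iUnion.1 (hwU ▸ mem_univ x)
  have hwK : ∀ i, w i ⊆ K i := fun i =>
    subset_closure.trans ((hwv i).trans ((hvK i).trans interior_subset))
  have hfin : LocallyFinite fun i => closure (w i) := hvf.subset hwv
  refine ⟨{p | ∀ i, p.2 ∈ w i → p.1 ∈ K i}, ?_, ?_, ?_, ?_, ?_⟩
  · refine mem_nhdsSet_iff_forall.2 ?_
    rintro ⟨z, z'⟩ (rfl : z = z')
    have h2 := hfin.eventually_subset (fun _ => isClosed_closure) z
    have h1 : ∀ᶠ y in 𝓝 z, ∀ i ∈ {i | z ∈ closure (w i)}, y ∈ K i :=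
      (Filter.eventually_all_finite (hfin.point_finite z)).2 fun i hi =>
        mem_interior_iff_mem_nhds.1 (hvK i (hwv i hi))
    rw [nhds_prod_eq]
    filter_upwards [h1.prod_mk h2] with p hp i hi
    exact hp.1 i (hp.2 (subset_closure hi))
  · simp only [ofPred_forall]
    refine isClosed_iInter fun i => ?_
    simp only [imp_iff_not_or]
    exact ((hwo i).preimage continuous_snd).isClosed_compl.union
      ((hKc i).isClosed.preimage continuous_fst)
  · rintro ⟨y, x⟩ hp
    obtain ⟨i, hi⟩ := hcover x
    exact hKM i ⟨hp i hi, hwK i hi⟩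
  · intro a b z ha hb
    obtain ⟨i, hi⟩ := hcover z
    exact hKM i ⟨ha i hi, hb i hi⟩
  · intro x
    obtain ⟨i, hi⟩ := hcover x
    refine ⟨K i, hKc i, ?_⟩
    filter_upwards [(hwo i).mem_nhds hi] with x' hx' y hy using hy i hx'

end Diagonal

end TopAnosovPaper

/-- Topologically Anosov homeomorphisms are topologically stable. -/
theorem topologically_stable {X : Type*} [TopologicalSpace X]
    [FirstCountableTopology X] [LocallyCompactSpace X] [ParacompactSpace X] [T2Space X]
    (f : X ≃ₜ X) (hf : TopAnosov f) :
    ∀ B ∈ nhdsSet (Set.diagonal X), ∃ D ∈ nhdsSet (Set.diagonal X),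
      ∀ g : X ≃ₜ X, (∀ x : X, (f x, g x) ∈ D) →
        ∃ h : X → X, Continuous h ∧ (∀ x : X, (h x, x) ∈ B) ∧
          ∀ x : X, f (h x) = h (g x) := by
  intro B hB
  obtain ⟨⟨N, -, hN, hNexp⟩, hsh⟩ := hf
  obtain ⟨E, hE, hEc, hEM, hEE, hEK⟩ :=
    exists_isClosed_nhdsSet_diagonal_comp_subset (Filter.inter_mem hN hB)
  obtain ⟨D, hD, hDsh⟩ := hsh E hE
  refine ⟨D, hD, fun g hg => ?_⟩
  have hex : ∀ x, ∃ y, Traces f E y fun i => iter g i x := by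
    refine fun x => hDsh _ fun i => ?_
    have := iter_add_one g (i - 1) x
    rw [sub_add_cancel] at this
    simpa only [this] using hg (iter g (i - 1) x)
  choose h hh using hex
  have huniq : ∀ x y, Traces f E y (fun i => iter g i x) → y = h x := by
    intro x y hy
    by_contra hne
    obtain ⟨n, hn⟩ := hNexp _ _ hne
    exact hn (hEE _ _ _ (hy n) (hh x n)).1
  have hE0 : ∀ x, (h x, x) ∈ E := fun x => hh x 0
  refine ⟨h, ?_, fun x => (hEM (hE0 x)).2, fun x => huniq _ _ fun i => ?_⟩
  · refine continuous_of_isClosed_graph_of_eventually_mem_compact ?_ fun x => ?_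
    · have hG : {p : X × X | p.2 = h p.1} =
          ⋂ i : ℤ, (fun p : X × X => (iter f i p.2, iter g i p.1)) ⁻¹' E := by
        ext ⟨x, y⟩
        simp only [mem_ofPred_eq, mem_iInter, mem_preimage]
        exact ⟨fun hy => hy ▸ hh x, huniq x y⟩
      rw [hG]
      exact isClosed_iInter fun i => hEc.preimage
        (((continuous_iter f i).comp continuous_snd).prodMk
          ((continuous_iter g i).comp continuous_fst))
    · obtain ⟨K, hK, hx⟩ := hEK x
      exact ⟨K, hK, hx.mono fun x' hx' => hx' _ (hE0 x')⟩
  · simpa only [iter_add_one_apply] using hh x (i + 1)
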